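/- Let d ∈ ℕ, let b₁,…,b_d ∈ C³([0,1]^d,ℝ) satisfy for all i ∈ {1,…,d} and all x = (x₁,…,x_d) ∈ [0,1]^d with x_i ∈ {0,1} that (−1)^{x_i} b_i(x) ≥ 0, and let y be the associated flow. Assume additionally (as follows from standard ODE theory) that for every t ∈ [0,∞) the map x ↦ y(t,x) is continuously differentiable on [0,1]^d with partial derivatives jointly continuous in (t,x). Then for every f ∈ C¹([0,1]^d,ℝ) and every t ∈ [0,∞) it holds that T¹_t f ∈ C¹([0,1]^d,ℝ) and ‖T¹_t f‖_{C¹} ≤ e^{λ₁ t} ‖f‖_{C¹}. -/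

import Mathlib

open MeasureTheory Filter

noncomputable section

/-- The unit cube `[0,1]^d` in `ℝ^d`. -/
def cube (d : ℕ) : Set (Fin d → ℝ) := Set.univ.pi fun _ => Set.Icc (0:ℝ) 1

/-- Partial derivative in coordinate `i` (within `[0,1]`, i.e. one-sided at the boundary). -/
def pd (d : ℕ) (i : Fin d) (g : (Fin d → ℝ) → ℝ) : (Fin d → ℝ) → ℝ :=
  fun x => derivWithin (fun t => g (Function.update x i t)) (Set.Icc (0:ℝ) 1) (x i)

/-- Iterated partial derivative `∂^α` (coordinates applied in a fixed order). -/
def mderiv (d : ℕ) (α : Fin d → ℕ) (f : (Fin d → ℝ) → ℝ) : (Fin d → ℝ) → ℝ :=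
  List.foldr (fun i g => (pd d i)^[α i] g) f (List.finRange d)

/-- `f ∈ C^m([0,1]^d, ℝ)`: all partial derivatives of order `0` through `m` exist
(one-sidedly at the boundary) and are continuous on the cube. -/
def MemCm (d : ℕ) : ℕ → ((Fin d → ℝ) → ℝ) → Prop
  | 0, f => ContinuousOn f (cube d)
  | m + 1, f => ContinuousOn f (cube d) ∧ ∀ i : Fin d,
      (∀ x ∈ cube d, DifferentiableWithinAt ℝ (fun t => f (Function.update x i t))
        (Set.Icc (0:ℝ) 1) (x i)) ∧
      MemCm d m (pd d i f)

/-- Sup norm over the cube: `‖g‖_∞ = sup_{x ∈ [0,1]^d} |g(x)|`. -/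
def supCube (d : ℕ) (g : (Fin d → ℝ) → ℝ) : ℝ := ⨆ x : cube d, |g x.1|

/-- The `C^m`-norm: `max_{|α| ≤ m} sup_{x ∈ [0,1]^d} |∂^α f(x)|`. -/
def CmNorm (d m : ℕ) (f : (Fin d → ℝ) → ℝ) : ℝ :=
  ⨆ α : {α : Fin d → ℕ // (∑ i, α i) ≤ m}, supCube d (mderiv d α.1 f)

/-- `λ_m := max_{0 < |α| ≤ m} ∑_i ‖∂^α b_i‖_∞`. -/
def lamNorm (d m : ℕ) (b : Fin d → (Fin d → ℝ) → ℝ) : ℝ :=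
  ⨆ α : {α : Fin d → ℕ // 0 < (∑ i, α i) ∧ (∑ i, α i) ≤ m},
    ∑ i, supCube d (mderiv d α.1 (b i))

theorem apply_mem_Icc_of_mem_cube {d : ℕ} {x : Fin d → ℝ} (hx : x ∈ cube d) (i : Fin d) :
    x i ∈ Set.Icc (0:ℝ) 1 := hx i (Set.mem_univ i)

theorem update_mem_cube {d : ℕ} {x : Fin d → ℝ} (hx : x ∈ cube d) (i : Fin d) {t : ℝ}
    (ht : t ∈ Set.Icc (0:ℝ) 1) : Function.update x i t ∈ cube d := by
  intro j _
  by_cases h : j = i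
  · subst h; simpa using ht
  · simpa [h] using hx j (Set.mem_univ j)

theorem isCompact_cube (d : ℕ) : IsCompact (cube d) :=
  isCompact_univ_pi fun _ => isCompact_Icc

theorem zero_mem_cube (d : ℕ) : (0 : Fin d → ℝ) ∈ cube d := fun _ _ => by simp

/-- Mean value inequality on a box, one coordinate at a time. -/
theorem abs_sub_le_sum_of_partials {d : ℕ} {s : Fin d → Set ℝ} (hs : ∀ i, Convex ℝ (s i))
    {g : (Fin d → ℝ) → ℝ} {D : Fin d → (Fin d → ℝ) → ℝ} {C : Fin d → ℝ}
    (hD : ∀ k, ∀ x ∈ Set.univ.pi s,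
      HasDerivWithinAt (fun t => g (Function.update x k t)) (D k x) (s k) (x k))
    (hC : ∀ k, ∀ x ∈ Set.univ.pi s, |D k x| ≤ C k)
    {x z : Fin d → ℝ} (hx : x ∈ Set.univ.pi s) (hz : z ∈ Set.univ.pi s) :
    |g z - g x| ≤ ∑ k, C k * |z k - x k| := by
  have key : ∀ T : Finset (Fin d), |g (T.piecewise z x) - g x| ≤ ∑ k ∈ T, C k * |z k - x k| := by
    intro T
    induction T using Finset.induction_on with
    | empty => simp
    | insert k T hk ih =>
      set w := T.piecewise z x with hw
      have hwm : w ∈ Set.univ.pi s := by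
        intro j _
        by_cases hj : j ∈ T
        · simpa [hw, hj] using hz j (Set.mem_univ j)
        · simpa [hw, hj] using hx j (Set.mem_univ j)
      have hwk : w k = x k := by simp [hw, hk]
      have hup : ∀ t ∈ s k, Function.update w k t ∈ Set.univ.pi s := by
        intro t ht j _
        by_cases h : j = k
        · subst h; simpa using ht
        · simpa [h] using hwm j (Set.mem_univ j)
      have h1 := Convex.norm_image_sub_le_of_norm_hasDerivWithin_le
        (f := fun t => g (Function.update w k t))
        (f' := fun t => D k (Function.update w k t)) (C := C k) (s := s k)
        (x := x k) (y := z k)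
        (fun t ht => by simpa using hD k _ (hup t ht))
        (fun t ht => by simpa using hC k _ (hup t ht)) (hs k)
        (hx k (Set.mem_univ k)) (hz k (Set.mem_univ k))
      rw [Finset.piecewise_insert, Finset.sum_insert hk, ← hw]
      have h2 : Function.update w k (x k) = w := by rw [← hwk]; simp
      simp only [h2, Real.norm_eq_abs] at h1
      have h3 := abs_sub_le (g (Function.update w k (z k))) (g w) (g x)
      linarith
  simpa using key Finset.univ

theorem MemCm.continuousOn {d m : ℕ} {f : (Fin d → ℝ) → ℝ} (hf : MemCm d m f) :
    ContinuousOn f (cube d) := by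
  cases m with
  | zero => exact hf
  | succ m => exact hf.1

theorem MemCm.hasDerivWithinAt {d m : ℕ} {f : (Fin d → ℝ) → ℝ} (hf : MemCm d (m + 1) f)
    (i : Fin d) {x : Fin d → ℝ} (hx : x ∈ cube d) :
    HasDerivWithinAt (fun t => f (Function.update x i t)) (pd d i f x) (Set.Icc (0:ℝ) 1) (x i) :=
  ((hf.2 i).1 x hx).hasDerivWithinAt

theorem MemCm.continuousOn_pd {d m : ℕ} {f : (Fin d → ℝ) → ℝ} (hf : MemCm d (m + 1) f)
    (i : Fin d) : ContinuousOn (pd d i f) (cube d) := (hf.2 i).2.continuousOn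

theorem MemCm.hasFDerivWithinAt {d m : ℕ} {f : (Fin d → ℝ) → ℝ} (hf : MemCm d (m + 1) f)
    {x : Fin d → ℝ} (hx : x ∈ cube d) :
    HasFDerivWithinAt f
      (∑ j, pd d j f x • (ContinuousLinearMap.proj j : (Fin d → ℝ) →L[ℝ] ℝ)) (cube d) x := by
  rw [hasFDerivWithinAt_iff_isLittleO, Asymptotics.isLittleO_iff]
  intro ε hε
  set η := ε / (d + 1) with hη
  have hd1 : (0:ℝ) < d + 1 := by positivity
  have hη0 : 0 < η := by positivity
  have h1 : ∀ᶠ z in nhdsWithin x (cube d), ∀ j, |pd d j f z - pd d j f x| ≤ η := by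
    rw [Filter.eventually_all]
    intro j
    have := (hf.continuousOn_pd j) x hx
    filter_upwards [this (Metric.ball_mem_nhds _ hη0)] with z hz
    exact le_of_lt (by simpa [Real.dist_eq] using hz)
  rw [eventually_nhdsWithin_iff, Metric.eventually_nhds_iff] at h1
  obtain ⟨δ, hδ, h1⟩ := h1
  rw [eventually_nhdsWithin_iff, Metric.eventually_nhds_iff]
  refine ⟨δ, hδ, fun z hz hzc => ?_⟩
  set s : Fin d → Set ℝ := fun j => Set.Icc (0:ℝ) 1 ∩ Metric.ball (x j) δ with hs
  have hbox : ∀ w ∈ Set.univ.pi s, w ∈ cube d ∧ dist w x < δ := fun w hw =>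
    ⟨fun j hj => (hw j hj).1, (dist_pi_lt_iff hδ).2 fun j => (hw j (Set.mem_univ j)).2⟩
  have hxs : x ∈ Set.univ.pi s := fun j hj => ⟨hx j hj, Metric.mem_ball_self hδ⟩
  have hzs : z ∈ Set.univ.pi s := fun j hj => ⟨hzc j hj, (dist_pi_lt_iff hδ).1 hz j⟩
  have key := abs_sub_le_sum_of_partials (s := s)
    (g := fun w => f w - ∑ j, pd d j f x * w j)
    (D := fun k w => pd d k f w - pd d k f x) (C := fun _ => η)
    (fun j => (convex_Icc 0 1).inter (convex_ball _ _)) ?_ ?_ hxs hzs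
  · have e : f z - f x - (∑ j, pd d j f x • (ContinuousLinearMap.proj j : (Fin d → ℝ) →L[ℝ] ℝ))
        (z - x) = (f z - ∑ j, pd d j f x * z j) - (f x - ∑ j, pd d j f x * x j) := by
      simp [mul_sub, Finset.sum_sub_distrib]
      ring
    rw [e, Real.norm_eq_abs]
    refine key.trans ?_
    calc ∑ k, η * |z k - x k| ≤ ∑ _k : Fin d, η * ‖z - x‖ :=
          Finset.sum_le_sum fun k _ =>
            mul_le_mul_of_nonneg_left (norm_le_pi_norm (z - x) k) hη0.le
      _ = d * η * ‖z - x‖ := by simp [mul_assoc]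
      _ ≤ ε * ‖z - x‖ := by
          gcongr
          rw [hη, mul_div_assoc', div_le_iff₀ hd1]
          nlinarith
  · intro k w hw
    have a := (hf.hasDerivWithinAt k (hbox w hw).1).mono (Set.inter_subset_left (t := Metric.ball (x k) δ))
    refine a.sub ?_
    have b : HasDerivAt (fun t => ∑ j, pd d j f x * Function.update w k t j)
        (∑ j, pd d j f x * (Pi.single k (1:ℝ) : Fin d → ℝ) j) (w k) :=
      HasDerivAt.fun_sum fun j _ =>
        ((hasDerivAt_pi.1 (hasDerivAt_update w k (w k))) j).const_mul _
    simpa [Pi.single_apply] using b.hasDerivWithinAt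
  · intro k w hw
    exact h1 (hbox w hw).2 (hbox w hw).1 k

theorem le_supCube {d : ℕ} {g : (Fin d → ℝ) → ℝ} (hg : ContinuousOn g (cube d))
    {x : Fin d → ℝ} (hx : x ∈ cube d) : |g x| ≤ supCube d g := by
  have hb : BddAbove (Set.range fun x : cube d => |g x.1|) := by
    have := (isCompact_cube d).bddAbove_image hg.abs
    rwa [Set.image_eq_range] at this
  exact le_ciSup hb ⟨x, hx⟩

theorem supCube_nonneg {d : ℕ} (g : (Fin d → ℝ) → ℝ) : 0 ≤ supCube d g :=
  Real.iSup_nonneg fun _ => abs_nonneg _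

theorem supCube_le {d : ℕ} {g : (Fin d → ℝ) → ℝ} {M : ℝ} (h : ∀ x ∈ cube d, |g x| ≤ M) :
    supCube d g ≤ M :=
  have : Nonempty (cube d) := ⟨⟨0, zero_mem_cube d⟩⟩
  ciSup_le fun x => h x.1 x.2

theorem mderiv_zero (d : ℕ) (f : (Fin d → ℝ) → ℝ) : mderiv d 0 f = f := by
  unfold mderiv
  simp

theorem mderiv_single (d : ℕ) (i : Fin d) (f : (Fin d → ℝ) → ℝ) :
    mderiv d (Pi.single i 1) f = pd d i f := by
  have key : ∀ l : List (Fin d), l.Nodup →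
      List.foldr (fun j g => (pd d j)^[(Pi.single i 1 : Fin d → ℕ) j] g) f l
        = if i ∈ l then pd d i f else f := by
    intro l
    induction l with
    | nil => simp
    | cons a l ih =>
      intro h
      rw [List.nodup_cons] at h
      rw [List.foldr_cons, ih h.2]
      by_cases ha : a = i
      · subst ha; simp [h.1]
      · simp [ha, Ne.symm ha]
  unfold mderiv
  rw [key _ (List.nodup_finRange d)]
  simp

theorem finite_multiIndex (d m : ℕ) : {α : Fin d → ℕ | (∑ i, α i) ≤ m}.Finite := by
  refine (Set.finite_Iic (fun _ : Fin d => m)).subset fun α hα i => ?_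
  exact (Finset.single_le_sum (f := α) (fun _ _ => Nat.zero_le _) (Finset.mem_univ i)).trans hα

theorem eq_zero_or_single_of_sum_le_one {d : ℕ} {α : Fin d → ℕ} (h : (∑ i, α i) ≤ 1) :
    α = 0 ∨ ∃ i, α = Pi.single i 1 := by
  by_cases h0 : α = 0
  · exact Or.inl h0
  · right
    obtain ⟨i, hi⟩ := Function.ne_iff.1 h0
    refine ⟨i, funext fun j => ?_⟩
    have hs := Finset.add_sum_erase Finset.univ α (Finset.mem_univ i)
    simp only [Pi.zero_apply] at hi
    by_cases hj : j = i
    · subst hj; rw [Pi.single_eq_same]; omega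
    · have := Finset.single_le_sum (f := α) (s := Finset.univ.erase i)
        (fun _ _ => Nat.zero_le _) (Finset.mem_erase.2 ⟨hj, Finset.mem_univ j⟩)
      rw [Pi.single_eq_of_ne hj]; omega

theorem supCube_mderiv_le_CmNorm {d m : ℕ} (f : (Fin d → ℝ) → ℝ) {α : Fin d → ℕ}
    (hα : (∑ i, α i) ≤ m) : supCube d (mderiv d α f) ≤ CmNorm d m f := by
  have : Finite {α : Fin d → ℕ // (∑ i, α i) ≤ m} := finite_multiIndex d m
  exact le_ciSup (f := fun α : {α : Fin d → ℕ // (∑ i, α i) ≤ m} => supCube d (mderiv d α.1 f))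
    (Set.finite_range _).bddAbove ⟨α, hα⟩

theorem sum_supCube_mderiv_le_lamNorm {d m : ℕ} (b : Fin d → (Fin d → ℝ) → ℝ) {α : Fin d → ℕ}
    (hα : 0 < (∑ i, α i) ∧ (∑ i, α i) ≤ m) :
    ∑ i, supCube d (mderiv d α (b i)) ≤ lamNorm d m b := by
  have : Finite {α : Fin d → ℕ // 0 < (∑ i, α i) ∧ (∑ i, α i) ≤ m} :=
    (finite_multiIndex d m).subset fun _ h => h.2
  exact le_ciSup (f := fun α : {α : Fin d → ℕ // 0 < (∑ i, α i) ∧ (∑ i, α i) ≤ m} =>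
    ∑ i, supCube d (mderiv d α.1 (b i))) (Set.finite_range _).bddAbove ⟨α, hα⟩

theorem supCube_le_CmNorm {d : ℕ} (m : ℕ) (f : (Fin d → ℝ) → ℝ) :
    supCube d f ≤ CmNorm d m f := by
  simpa [mderiv_zero] using supCube_mderiv_le_CmNorm (m := m) f (α := 0) (by simp)

theorem supCube_pd_le_CmNorm {d : ℕ} (i : Fin d) (f : (Fin d → ℝ) → ℝ) :
    supCube d (pd d i f) ≤ CmNorm d 1 f := by
  simpa [mderiv_single] using supCube_mderiv_le_CmNorm (m := 1) f (α := Pi.single i 1) (by simp)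

theorem sum_supCube_pd_le_lamNorm {d : ℕ} (i : Fin d) (b : Fin d → (Fin d → ℝ) → ℝ) :
    ∑ j, supCube d (pd d i (b j)) ≤ lamNorm d 1 b := by
  simpa [mderiv_single] using
    sum_supCube_mderiv_le_lamNorm (m := 1) b (α := Pi.single i 1) (by simp)

theorem lamNorm_nonneg {d m : ℕ} (b : Fin d → (Fin d → ℝ) → ℝ) : 0 ≤ lamNorm d m b :=
  Real.iSup_nonneg fun _ => Finset.sum_nonneg fun _ _ => supCube_nonneg _

theorem CmNorm_one_le {d : ℕ} {f : (Fin d → ℝ) → ℝ} {M : ℝ} (h0 : supCube d f ≤ M)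
    (h1 : ∀ i, supCube d (pd d i f) ≤ M) : CmNorm d 1 f ≤ M := by
  have : Nonempty {α : Fin d → ℕ // (∑ i, α i) ≤ 1} := ⟨⟨0, by simp⟩⟩
  refine ciSup_le fun α => ?_
  obtain h | ⟨i, h⟩ := eq_zero_or_single_of_sum_le_one α.2
  · simpa [h, mderiv_zero] using h0
  · simpa [h, mderiv_single] using h1 i

/-- A `C¹` function on the cube is Lipschitz with coordinatewise constants. -/
theorem MemCm.abs_sub_le {d m : ℕ} {f : (Fin d → ℝ) → ℝ} (hf : MemCm d (m + 1) f)
    {x z : Fin d → ℝ} (hx : x ∈ cube d) (hz : z ∈ cube d) :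
    |f z - f x| ≤ ∑ k, supCube d (pd d k f) * |z k - x k| :=
  abs_sub_le_sum_of_partials (s := fun _ => Set.Icc (0:ℝ) 1) (fun _ => convex_Icc 0 1)
    (fun k _ hw => hf.hasDerivWithinAt k hw)
    (fun k _ hw => le_supCube (hf.continuousOn_pd k) hw) hx hz

theorem abs_le_of_hasDerivWithinAt_of_lipschitz {φ : ℝ → ℝ} {φ' C a : ℝ}
    (h : HasDerivWithinAt φ φ' (Set.Icc (0:ℝ) 1) a) (ha : a ∈ Set.Icc (0:ℝ) 1)
    (hC : ∀ t ∈ Set.Icc (0:ℝ) 1, |φ t - φ a| ≤ C * |t - a|) : |φ'| ≤ C := by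
  have hne : (nhdsWithin a (Set.Icc (0:ℝ) 1 \ {a})).NeBot := by
    have := uniqueDiffWithinAt_iff_accPt.1 (uniqueDiffOn_Icc (zero_lt_one' ℝ) a ha)
    rwa [accPt_principal_iff_nhdsWithin] at this
  refine le_of_tendsto (hasDerivWithinAt_iff_tendsto_slope.1 h).abs ?_
  filter_upwards [self_mem_nhdsWithin] with t ht
  have hpos : 0 < |t - a| := abs_pos.2 (sub_ne_zero.2 ht.2)
  rw [slope_def_field, abs_div, div_le_iff₀ hpos]
  exact hC t ht.1

theorem continuousOn_primitive_of_bounded {h : ℝ → ℝ} {M : ℝ} (hM : ∀ s, 0 ≤ s → |h s| ≤ M) :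
    ContinuousOn (fun t => ∫ s in (0:ℝ)..t, h s)
      {t | 0 ≤ t ∧ IntervalIntegrable h volume 0 t} := by
  have hM0 : 0 ≤ M := (abs_nonneg _).trans (hM 0 le_rfl)
  refine LipschitzOnWith.continuousOn (K := M.toNNReal) (LipschitzOnWith.of_dist_le_mul ?_)
  intro t ht s hs
  rw [Real.dist_eq, Real.dist_eq, intervalIntegral.integral_interval_sub_left ht.2 hs.2,
    Real.coe_toNNReal _ hM0]
  exact intervalIntegral.norm_integral_le_of_norm_le_const (f := h) fun r hr =>
    hM r ((le_min hs.1 ht.1).trans hr.1.le)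

/-- Measurability holds without any integrability assumption on `h`: the integral vanishes
wherever `h` fails to be integrable. -/
theorem measurable_indicator_primitive_of_bounded {h : ℝ → ℝ} {M : ℝ}
    (hM : ∀ s, 0 ≤ s → |h s| ≤ M) :
    Measurable ((Set.Ici (0:ℝ)).indicator fun t => ∫ s in (0:ℝ)..t, h s) := by
  classical
  set A : Set ℝ := {t | 0 ≤ t ∧ IntervalIntegrable h volume 0 t} with hA
  have hAm : MeasurableSet A := by
    refine Set.OrdConnected.measurableSet ⟨fun a ha c hc r hr => ⟨ha.1.trans hr.1, ?_⟩⟩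
    refine hc.2.mono_set ?_
    rw [Set.uIcc_of_le hc.1, Set.uIcc_of_le (ha.1.trans hr.1)]
    exact Set.Icc_subset_Icc_right hr.2
  have e : (Set.Ici (0:ℝ)).indicator (fun t => ∫ s in (0:ℝ)..t, h s)
      = A.piecewise (fun t => ∫ s in (0:ℝ)..t, h s) (fun _ => 0) := by
    funext t
    by_cases h0 : 0 ≤ t
    · by_cases hi : IntervalIntegrable h volume 0 t
      · simp [Set.indicator, Set.piecewise, hA, h0, hi]
      · simp [Set.indicator, Set.piecewise, hA, h0, hi, intervalIntegral.integral_undef hi]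
    · simp [Set.indicator, Set.piecewise, hA, h0]
  rw [e]
  exact (continuousOn_primitive_of_bounded hM).measurable_piecewise continuousOn_const hAm

section Trajectory

variable {d : ℕ} {b : Fin d → (Fin d → ℝ) → ℝ} {z : ℝ → Fin d → ℝ} {x : Fin d → ℝ}

/-- A solution of the integral equation in the cube is continuous in time. -/
theorem trajectory_continuousOn (hb : ∀ i, ContinuousOn (b i) (cube d))
    (hz : ∀ t, 0 ≤ t → z t ∈ cube d)
    (hflow : ∀ i t, 0 ≤ t → z t i = x i + ∫ s in (0:ℝ)..t, b i (z s)) :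
    ContinuousOn z (Set.Ici 0) := by
  classical
  have hM : ∀ i s, 0 ≤ s → |b i (z s)| ≤ supCube d (b i) :=
    fun i s hs => le_supCube (hb i) (hz s hs)
  have hcube : MeasurableSet (cube d) := (isCompact_cube d).isClosed.measurableSet
  have hzm : Measurable fun s i =>
      x i + (Set.Ici (0:ℝ)).indicator (fun t => ∫ r in (0:ℝ)..t, b i (z r)) s :=
    measurable_pi_lambda _ fun i =>
      (measurable_indicator_primitive_of_bounded (hM i)).const_add _
  have hint : ∀ i t, 0 ≤ t → IntervalIntegrable (fun s => b i (z s)) volume 0 t := by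
    intro i t ht
    have hbm : Measurable ((cube d).piecewise (b i) (fun _ => 0)) :=
      (hb i).measurable_piecewise continuousOn_const hcube
    have hm := hbm.comp hzm
    rw [intervalIntegrable_iff_integrableOn_Ioc_of_le ht]
    have heq : ∀ s ∈ Set.Ioc 0 t, ((cube d).piecewise (b i) (fun _ => 0) ∘ fun s i =>
        x i + (Set.Ici (0:ℝ)).indicator (fun t => ∫ r in (0:ℝ)..t, b i (z r)) s) s
        = b i (z s) := by
      intro s hs
      have : (fun i => x i + (Set.Ici (0:ℝ)).indicator
          (fun t => ∫ r in (0:ℝ)..t, b i (z r)) s) = z s := by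
        funext j
        rw [Set.indicator_of_mem (Set.mem_Ici.2 hs.1.le), hflow j s hs.1.le]
      rw [Function.comp_apply, this]
      exact Set.piecewise_eq_of_mem _ _ _ (hz s hs.1.le)
    refine Integrable.of_bound (μ := volume.restrict (Set.Ioc 0 t)) ?_ (supCube d (b i)) ?_
    · exact hm.aestronglyMeasurable.congr
        ((ae_restrict_iff' measurableSet_Ioc).2 (Eventually.of_forall heq))
    · exact (ae_restrict_iff' measurableSet_Ioc).2
        (Eventually.of_forall fun s hs => hM i s hs.1.le)
  refine continuousOn_pi.2 fun i => ?_
  have hc := (continuousOn_primitive_of_bounded (hM i)).mono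
    (fun t (ht : t ∈ Set.Ici (0:ℝ)) => ⟨ht, hint i t ht⟩)
  exact (continuousOn_const.add hc).congr fun t ht => hflow i t ht

theorem trajectory_hasDerivWithinAt (hb : ∀ i, ContinuousOn (b i) (cube d))
    (hz : ∀ t, 0 ≤ t → z t ∈ cube d)
    (hflow : ∀ i t, 0 ≤ t → z t i = x i + ∫ s in (0:ℝ)..t, b i (z s))
    (i : Fin d) {t : ℝ} (ht : 0 ≤ t) :
    HasDerivWithinAt (fun s => z s i) (b i (z t)) (Set.Ici t) t := by
  have hcont : ContinuousOn (fun s => b i (z s)) (Set.Ici 0) :=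
    (hb i).comp (trajectory_continuousOn hb hz hflow) fun s hs => hz s hs
  have hH : Continuous fun s => b i (z (max s 0)) :=
    hcont.comp_continuous (f := fun s : ℝ => max s 0) (by fun_prop) fun s => le_max_right s 0
  have hd := ((hH.integral_hasStrictDerivAt 0 t).hasDerivAt.const_add (x i)).hasDerivWithinAt
    (s := Set.Ici t)
  rw [max_eq_left ht] at hd
  have heq : ∀ s ∈ Set.Ici t, z s i = x i + ∫ r in (0:ℝ)..s, b i (z (max r 0)) := by
    intro s hs
    have hs0 : 0 ≤ s := ht.trans hs
    rw [hflow i s hs0]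
    congr 1
    refine intervalIntegral.integral_congr fun r hr => ?_
    rw [Set.uIcc_of_le hs0] at hr
    simp only [max_eq_left hr.1]
  exact hd.congr heq (heq t Set.self_mem_Ici)

/-- Two trajectories separate in `ℓ¹` at most exponentially with rate `λ₁`. -/
theorem trajectory_sum_abs_sub_le {m : ℕ} (hb : ∀ i, MemCm d (m + 1) (b i))
    (hz : ∀ t, 0 ≤ t → z t ∈ cube d)
    (hflow : ∀ i t, 0 ≤ t → z t i = x i + ∫ s in (0:ℝ)..t, b i (z s))
    {z' : ℝ → Fin d → ℝ} {x' : Fin d → ℝ}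
    (hz' : ∀ t, 0 ≤ t → z' t ∈ cube d)
    (hflow' : ∀ i t, 0 ≤ t → z' t i = x' i + ∫ s in (0:ℝ)..t, b i (z' s))
    {t : ℝ} (ht : 0 ≤ t) :
    ∑ j, |z t j - z' t j| ≤ Real.exp (lamNorm d 1 b * t) * ∑ j, |x j - x' j| := by
  have hbc : ∀ i, ContinuousOn (b i) (cube d) := fun i => (hb i).continuousOn
  have hsub : Set.Icc 0 t ⊆ Set.Ici (0:ℝ) := fun s hs => hs.1
  have key := norm_le_gronwallBound_of_norm_deriv_right_le
    (f := fun s => (WithLp.toLp 1 (z s - z' s) : PiLp 1 fun _ : Fin d => ℝ))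
    (f' := fun s => WithLp.toLp 1 fun j => b j (z s) - b j (z' s))
    (δ := ∑ j, |x j - x' j|) (K := lamNorm d 1 b) (ε := 0) (a := 0) (b := t)
    ?_ ?_ ?_ ?_ t ⟨ht, le_rfl⟩
  · rw [gronwallBound_ε0, PiLp.norm_eq_of_L1, sub_zero, mul_comm] at key
    simpa using key
  · exact (PiLp.continuous_toLp 1 _).comp_continuousOn
      (((trajectory_continuousOn hbc hz hflow).sub
        (trajectory_continuousOn hbc hz' hflow')).mono hsub)
  · intro s hs
    have h : HasDerivWithinAt (fun r => z r - z' r) (fun j => b j (z s) - b j (z' s))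
        (Set.Ici s) s :=
      hasDerivWithinAt_pi.2 fun j =>
        (trajectory_hasDerivWithinAt hbc hz hflow j hs.1).sub
          (trajectory_hasDerivWithinAt hbc hz' hflow' j hs.1)
    exact ((PiLp.continuousLinearEquiv 1 ℝ
      fun _ : Fin d => ℝ).symm.hasFDerivAt).comp_hasDerivWithinAt s h
  · rw [PiLp.norm_eq_of_L1]
    refine Finset.sum_le_sum fun j _ => ?_
    simp [hflow j 0 le_rfl, hflow' j 0 le_rfl]
  · intro s hs
    rw [PiLp.norm_eq_of_L1, PiLp.norm_eq_of_L1, add_zero]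
    simp only [Real.norm_eq_abs, Pi.sub_apply]
    calc ∑ j, |b j (z s) - b j (z' s)|
        ≤ ∑ j, ∑ k, supCube d (pd d k (b j)) * |z s k - z' s k| :=
          Finset.sum_le_sum fun j _ => (hb j).abs_sub_le (hz' s hs.1) (hz s hs.1)
      _ = ∑ k, (∑ j, supCube d (pd d k (b j))) * |z s k - z' s k| := by
          rw [Finset.sum_comm]; simp_rw [Finset.sum_mul]
      _ ≤ ∑ k, lamNorm d 1 b * |z s k - z' s k| :=
          Finset.sum_le_sum fun k _ =>
            mul_le_mul_of_nonneg_right (sum_supCube_pd_le_lamNorm k b) (abs_nonneg _)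
      _ = lamNorm d 1 b * ∑ k, |z s k - z' s k| := by rw [Finset.mul_sum]

end Trajectory

/-- Composition of a `C¹` function with a `C¹` self-map of the cube is `C¹`. -/
theorem MemCm.comp {d : ℕ} {f : (Fin d → ℝ) → ℝ} (hf : MemCm d 1 f)
    {Y : (Fin d → ℝ) → Fin d → ℝ} (hY : ∀ x ∈ cube d, Y x ∈ cube d)
    (hYC : ∀ i, MemCm d 1 fun x => Y x i) : MemCm d 1 fun x => f (Y x) := by
  have hYc : ContinuousOn Y (cube d) := continuousOn_pi.2 fun i => (hYC i).continuousOn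
  have hder : ∀ i, ∀ x ∈ cube d, HasDerivWithinAt (fun t => f (Y (Function.update x i t)))
      (∑ j, pd d j f (Y x) * pd d i (fun x => Y x j) x) (Set.Icc (0:ℝ) 1) (x i) := by
    intro i x hx
    have h1 : HasDerivWithinAt (fun t => Y (Function.update x i t))
        (fun j => pd d i (fun x => Y x j) x) (Set.Icc (0:ℝ) 1) (x i) :=
      hasDerivWithinAt_pi.2 fun j => (hYC j).hasDerivWithinAt i hx
    have h2 := hf.hasFDerivWithinAt (hY x hx)
    have e : Y x = Y (Function.update x i (x i)) := by simp
    rw [e] at h2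
    have h3 := h2.comp_hasDerivWithinAt (x i) h1 fun t ht => hY _ (update_mem_cube hx i ht)
    simpa [sum_apply, Function.comp_def] using h3
  refine ⟨hf.continuousOn.comp hYc hY, fun i => ⟨fun x hx => (hder i x hx).differentiableWithinAt,
    ?_⟩⟩
  have hc : ContinuousOn (fun x => ∑ j, pd d j f (Y x) * pd d i (fun x => Y x j) x) (cube d) :=
    continuousOn_finsetSum _ fun j _ =>
      ((hf.continuousOn_pd j).comp hYc hY).mul ((hYC j).continuousOn_pd i)
  exact hc.congr fun x hx => (hder i x hx).derivWithin
    (uniqueDiffOn_Icc (zero_lt_one' ℝ) _ (apply_mem_Icc_of_mem_cube hx i))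

/-- `C¹`-estimate for the drift semigroup `T¹_t f = f ∘ y(t,·)`:
if `f ∈ C¹([0,1]^d,ℝ)` then `T¹_t f ∈ C¹([0,1]^d,ℝ)` and
`‖T¹_t f‖_{C¹} ≤ e^{λ₁ t} ‖f‖_{C¹}`. -/
theorem drift_semigroup_C1_estimate
    (d : ℕ) (hd : 0 < d)
    (b : Fin d → (Fin d → ℝ) → ℝ)
    (hb : ∀ i : Fin d, MemCm d 3 (b i))
    (hbdry : ∀ i : Fin d, ∀ x ∈ cube d,
      (x i = 0 → 0 ≤ b i x) ∧ (x i = 1 → b i x ≤ 0))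
    (y : ℝ → (Fin d → ℝ) → (Fin d → ℝ))
    (hy_cube : ∀ t ∈ Set.Ici (0:ℝ), ∀ x ∈ cube d, y t x ∈ cube d)
    (hy_flow : ∀ i : Fin d, ∀ t ∈ Set.Ici (0:ℝ), ∀ x ∈ cube d,
      y t x i = x i + ∫ s in (0:ℝ)..t, b i (y s x))
    (hy_C1 : ∀ t ∈ Set.Ici (0:ℝ), ∀ i : Fin d, MemCm d 1 (fun x => y t x i))
    (hy_joint : ∀ i j : Fin d, ContinuousOn
      (fun q : ℝ × (Fin d → ℝ) => pd d j (fun x => y q.1 x i) q.2)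
      (Set.Ici (0:ℝ) ×ˢ cube d))
    (f : (Fin d → ℝ) → ℝ) (hf : MemCm d 1 f) (t : ℝ) (ht : 0 ≤ t) :
    MemCm d 1 (fun x => f (y t x)) ∧
    CmNorm d 1 (fun x => f (y t x)) ≤ Real.exp (lamNorm d 1 b * t) * CmNorm d 1 f := by
  have hcomp : MemCm d 1 (fun x => f (y t x)) := hf.comp (hy_cube t ht) (hy_C1 t ht)
  refine ⟨hcomp, ?_⟩
  have hN : 0 ≤ CmNorm d 1 f := (supCube_nonneg f).trans (supCube_le_CmNorm 1 f)
  refine CmNorm_one_le ?_ fun i => supCube_le fun x hx => ?_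
  · refine (supCube_le fun x hx => ?_).trans
      (le_mul_of_one_le_left hN (Real.one_le_exp (mul_nonneg (lamNorm_nonneg b) ht)))
    exact (le_supCube hf.continuousOn (hy_cube t ht x hx)).trans (supCube_le_CmNorm 1 f)
  · refine abs_le_of_hasDerivWithinAt_of_lipschitz (hcomp.hasDerivWithinAt i hx)
      (apply_mem_Icc_of_mem_cube hx i) fun r hr => ?_
    have hu := update_mem_cube hx i hr
    have hdist : ∑ j, |Function.update x i r j - x j| = |r - x i| := by
      rw [Finset.sum_eq_single i (fun j _ hj => by simp [hj]) (by simp)]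
      simp
    have hsep := trajectory_sum_abs_sub_le (z := fun s => y s (Function.update x i r))
      (z' := fun s => y s x) hb (fun s hs => hy_cube s hs _ hu)
      (fun j s hs => hy_flow j s hs _ hu) (fun s hs => hy_cube s hs x hx)
      (fun j s hs => hy_flow j s hs x hx) ht
    rw [hdist] at hsep
    rw [Function.update_eq_self]
    calc |f (y t (Function.update x i r)) - f (y t x)|
        ≤ ∑ k, supCube d (pd d k f) * |y t (Function.update x i r) k - y t x k| :=
          hf.abs_sub_le (hy_cube t ht x hx) (hy_cube t ht _ hu)
      _ ≤ ∑ k, CmNorm d 1 f * |y t (Function.update x i r) k - y t x k| :=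
          Finset.sum_le_sum fun k _ =>
            mul_le_mul_of_nonneg_right (supCube_pd_le_CmNorm k f) (abs_nonneg _)
      _ = CmNorm d 1 f * ∑ k, |y t (Function.update x i r) k - y t x k| := by
          rw [Finset.mul_sum]
      _ ≤ CmNorm d 1 f * (Real.exp (lamNorm d 1 b * t) * |r - x i|) :=
          mul_le_mul_of_nonneg_left hsep hN
      _ = Real.exp (lamNorm d 1 b * t) * CmNorm d 1 f * |r - x i| := by ring

end
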